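/- arXiv:2411.04206 — 8 statements merged into one kernel-verified Lean document; each statement's English description precedes it below -/
import Mathlib

section
/- Under the stated hypotheses, the function R satisfies, for every c ∈ I, the differential equation R′(c) = 6·R(c)·(1 + R(c)) / (1 − c² + c·(2 − c)·R(c)). (Note that the denominator is strictly positive since 0 < c < 1 and R(c) > 0.) -/
/-- For an open interval `I ⊆ (0,1)` and differentiable positive functions
`A₁, A₂, B` satisfying the algebraic relation `c⁻²A₁(c) + (1-c)⁻²A₂(c) = B(c)²` and the
logarithmic-derivative relations, the function `R(c) = (c/(1-c))² A₂(c)/A₁(c)` satisfies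
the ODE `R′(c) = 6 R(c)(1+R(c)) / (1 - c² + c(2-c) R(c))` on `I`. -/
theorem angelesco_R_ode
    (I : Set ℝ) (hIopen : IsOpen I) (hIconn : I.OrdConnected)
    (hIsub : I ⊆ Set.Ioo (0 : ℝ) 1)
    (A₁ A₂ B : ℝ → ℝ)
    (hA₁diff : ∀ c ∈ I, DifferentiableAt ℝ A₁ c)
    (hA₂diff : ∀ c ∈ I, DifferentiableAt ℝ A₂ c)
    (hBdiff : ∀ c ∈ I, DifferentiableAt ℝ B c)
    (hA₁pos : ∀ c ∈ I, 0 < A₁ c)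
    (hA₂pos : ∀ c ∈ I, 0 < A₂ c)
    (hBpos : ∀ c ∈ I, 0 < B c)
    (halg : ∀ c ∈ I, A₁ c / c ^ 2 + A₂ c / (1 - c) ^ 2 = (B c) ^ 2)
    (hlog₁ : ∀ c ∈ I, deriv B c / B c = -(c / (1 - c)) * (deriv A₁ c / A₁ c))
    (hlog₂ : ∀ c ∈ I, deriv B c / B c = -((1 - c) / c) * (deriv A₂ c / A₂ c))
    (R : ℝ → ℝ) (hR : ∀ c, R c = (c / (1 - c)) ^ 2 * (A₂ c / A₁ c)) :
    ∀ c ∈ I, deriv R c = 6 * R c * (1 + R c) / (1 - c ^ 2 + c * (2 - c) * R c) := by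
  intro c hc
  obtain ⟨h0, h1⟩ := hIsub hc
  have hs : 0 < 1 - c := by linarith
  have hc0 : c ≠ 0 := h0.ne'
  have hs0 : 1 - c ≠ 0 := hs.ne'
  have p1 := hA₁pos c hc
  have p2 := hA₂pos c hc
  have pB := hBpos c hc
  have d1 := (hA₁diff c hc).hasDerivAt
  have d2 := (hA₂diff c hc).hasDerivAt
  have dB := (hBdiff c hc).hasDerivAt
  have l1 := hlog₁ c hc
  have l2 := hlog₂ c hc
  have ha := halg c hc
  obtain ⟨b, hb⟩ : ∃ b, deriv B c / B c = b := ⟨_, rfl⟩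
  rw [hb] at l1 l2
  have e1 : deriv A₁ c = -b * (1 - c) / c * A₁ c := by
    rw [l1]; field_simp
  have e2 : deriv A₂ c = -b * c / (1 - c) * A₂ c := by
    rw [l2]; field_simp
  have eB : deriv B c = b * B c := by
    rw [← hb]; field_simp
  rw [e1] at d1
  rw [e2] at d2
  rw [eB] at dB
  have dc := hasDerivAt_id' c
  have ds : HasDerivAt (fun x : ℝ => 1 - x) (-1) c := by
    simpa using dc.const_sub 1
  have dl := (d1.div (dc.pow 2) (pow_ne_zero 2 hc0)).add (d2.div (ds.pow 2) (pow_ne_zero 2 hs0))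
  have dr := dB.pow 2
  have hev : (B ^ 2) =ᶠ[nhds c] (A₁ / (fun x : ℝ => x) ^ 2 + A₂ / (fun x : ℝ => 1 - x) ^ 2) := by
    filter_upwards [hIopen.mem_nhds hc] with x hx
    simpa using (halg x hx).symm
  have key := (dl.congr_of_eventuallyEq hev).unique dr
  have dR := ((dc.div ds hs0).pow 2).mul (d2.div d1 p1.ne')
  have hRf : R = ((fun x : ℝ => x) / (fun x : ℝ => 1 - x)) ^ 2 * (A₂ / A₁) := by
    funext x; simp [hR x]
  rw [← hRf] at dR
  rw [dR.deriv]
  obtain ⟨r, hr⟩ : ∃ r, R c = r := ⟨_, rfl⟩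
  have hr' := hR c
  rw [hr] at hr' ⊢
  have hrpos : 0 < r := by rw [hr']; positivity
  have eA : A₂ c = r * (1 - c) ^ 2 / c ^ 2 * A₁ c := by
    rw [hr']; field_simp
  have hD : 0 < 1 - c ^ 2 + c * (2 - c) * r := by
    have : 0 < c * (2 - c) * r := by
      have : 0 < 2 - c := by linarith
      positivity
    nlinarith
  have hB2 : B c * (b * B c) = b * (A₁ c / c ^ 2 + A₂ c / (1 - c) ^ 2) := by
    rw [ha]; ring
  have kb : b * (1 - c ^ 2 + c * (2 - c) * r) = 2 * (c * r - (1 - c)) := by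
    have key' := key
    simp only [Pi.pow_apply, Nat.cast_ofNat, Nat.add_one_sub_one, pow_one] at key'
    rw [mul_assoc 2 (B c), hB2, eA] at key'
    field_simp at key'
    linear_combination -key'
  have fin : (b * (1 - 2 * c) + 2) * (1 - c ^ 2 + c * (2 - c) * r) = 6 * c * (1 - c) * (1 + r) := by
    linear_combination (1 - 2 * c) * kb
  rw [eq_div_iff hD.ne']
  simp only [Pi.pow_apply, Pi.div_apply, eA]
  simp
  field_simp
  linear_combination fin
end

section
/- Under the stated hypotheses, for every c ∈ I one has B′(c)/B(c) = −2·(1 − c − c·R(c)) / (1 − c² + c·(2 − c)·R(c)). -/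
/-- Under the hypotheses on `A₁, A₂, B` attached to an Angelesco system,
with `R(c) = (c/(1-c))² A₂(c)/A₁(c)`, one has
`B′(c)/B(c) = -2 (1 - c - c R(c)) / (1 - c² + c(2-c) R(c))` on `I`. -/
theorem angelesco_B_log_deriv
    (I : Set ℝ) (hIopen : IsOpen I) (hIconn : I.OrdConnected)
    (hIsub : I ⊆ Set.Ioo (0 : ℝ) 1)
    (A₁ A₂ B : ℝ → ℝ)
    (hA₁diff : ∀ c ∈ I, DifferentiableAt ℝ A₁ c)
    (hA₂diff : ∀ c ∈ I, DifferentiableAt ℝ A₂ c)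
    (hBdiff : ∀ c ∈ I, DifferentiableAt ℝ B c)
    (hA₁pos : ∀ c ∈ I, 0 < A₁ c)
    (hA₂pos : ∀ c ∈ I, 0 < A₂ c)
    (hBpos : ∀ c ∈ I, 0 < B c)
    (halg : ∀ c ∈ I, A₁ c / c ^ 2 + A₂ c / (1 - c) ^ 2 = (B c) ^ 2)
    (hlog₁ : ∀ c ∈ I, deriv B c / B c = -(c / (1 - c)) * (deriv A₁ c / A₁ c))
    (hlog₂ : ∀ c ∈ I, deriv B c / B c = -((1 - c) / c) * (deriv A₂ c / A₂ c))
    (R : ℝ → ℝ) (hR : ∀ c, R c = (c / (1 - c)) ^ 2 * (A₂ c / A₁ c)) :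
    ∀ c ∈ I, deriv B c / B c =
      -2 * (1 - c - c * R c) / (1 - c ^ 2 + c * (2 - c) * R c) := by
  intro c hc
  obtain ⟨h0, h1⟩ := hIsub hc
  have hd : 0 < 1 - c := by linarith
  have hc0 : c ≠ 0 := h0.ne'
  have hd0 : 1 - c ≠ 0 := hd.ne'
  have ha1 := hA₁pos c hc
  have ha2 := hA₂pos c hc
  have hb := hBpos c hc
  have e1 := hlog₁ c hc
  have e2 := hlog₂ c hc
  have e0 := halg c hc
  have D1 := (hA₁diff c hc).hasDerivAt
  have D2 := (hA₂diff c hc).hasDerivAt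
  have DB := ((hBdiff c hc).hasDerivAt).pow 2
  have Dc : HasDerivAt (fun t : ℝ => t ^ 2) (2 * c) c := by
    simpa using hasDerivAt_pow 2 c
  have Dd : HasDerivAt (fun t : ℝ => (1 - t) ^ 2) (-2 * (1 - c)) c := by
    have := ((hasDerivAt_id c).const_sub 1).pow 2
    refine HasDerivAt.congr_deriv this ?_
    simp
  have DL := (D1.div Dc (by positivity)).add (D2.div Dd (by positivity))
  have hev : (B ^ 2) =ᶠ[nhds c]
      (A₁ / (fun t : ℝ => t ^ 2) + A₂ / (fun t : ℝ => (1 - t) ^ 2)) := by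
    filter_upwards [hIopen.mem_nhds hc] with t ht
    simpa using (halg t ht).symm
  have key := (DL.congr_of_eventuallyEq hev).unique DB
  have hRc := hR c
  have hRpos : 0 < R c := by rw [hRc]; positivity
  have hden : 0 < 1 - c ^ 2 + c * (2 - c) * R c := by
    have : 0 < c * (2 - c) * R c := by
      have : 0 < 2 - c := by linarith
      positivity
    nlinarith
  rw [eq_div_iff hden.ne']
  generalize R c = r at *
  generalize hx : deriv B c / B c = x at *
  have f0 : deriv B c = x * B c := by rw [← hx]; field_simp
  have f1 : deriv A₁ c = -x * (1 - c) / c * A₁ c := by rw [e1]; field_simp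
  have f2 : deriv A₂ c = -x * c / (1 - c) * A₂ c := by rw [e2]; field_simp
  have f3 : A₂ c = r * A₁ c * (1 - c) ^ 2 / c ^ 2 := by rw [hRc]; field_simp
  have key2 : (deriv A₁ c * c ^ 2 - A₁ c * (2 * c)) / (c ^ 2) ^ 2 +
      (deriv A₂ c * (1 - c) ^ 2 - A₂ c * (-2 * (1 - c))) / ((1 - c) ^ 2) ^ 2
      = 2 * x * (A₁ c / c ^ 2 + A₂ c / (1 - c) ^ 2) := by
    rw [e0, key, f0]; push_cast; ring
  rw [f1, f2, f3] at key2
  clear * - key2 hc0 hd0 ha1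
  have ha : A₁ c ≠ 0 := ha1.ne'
  field_simp at key2
  linear_combination -key2
end

section
/- Under the stated hypotheses, define R₁(c) := c⁻²·A₁(c) and R₂(c) := (1−c)⁻²·A₂(c). Then for every c ∈ I one has R₂′(c)/R₂(c) = 2·(2c + 1 + 2c·R(c)) / (1 − c² + c·(2 − c)·R(c)) and R₁′(c)/R₁(c) = −2·(2(1−c) + (3−2c)·R(c)) / (1 − c² + c·(2 − c)·R(c)). -/
/-- Under the hypotheses on `A₁, A₂, B` attached to an Angelesco system,
with `R(c) = (c/(1-c))² A₂(c)/A₁(c)`, `R₁(c) = c⁻² A₁(c)` and `R₂(c) = (1-c)⁻² A₂(c)`,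
one has `R₂′/R₂ = 2(2c+1+2cR)/(1-c²+c(2-c)R)` and
`R₁′/R₁ = -2(2(1-c)+(3-2c)R)/(1-c²+c(2-c)R)` on `I`. -/
theorem angelesco_R1_R2_log_derivs
    (I : Set ℝ) (hIopen : IsOpen I) (hIconn : I.OrdConnected)
    (hIsub : I ⊆ Set.Ioo (0 : ℝ) 1)
    (A₁ A₂ B : ℝ → ℝ)
    (hA₁diff : ∀ c ∈ I, DifferentiableAt ℝ A₁ c)
    (hA₂diff : ∀ c ∈ I, DifferentiableAt ℝ A₂ c)
    (hBdiff : ∀ c ∈ I, DifferentiableAt ℝ B c)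
    (hA₁pos : ∀ c ∈ I, 0 < A₁ c)
    (hA₂pos : ∀ c ∈ I, 0 < A₂ c)
    (hBpos : ∀ c ∈ I, 0 < B c)
    (halg : ∀ c ∈ I, A₁ c / c ^ 2 + A₂ c / (1 - c) ^ 2 = (B c) ^ 2)
    (hlog₁ : ∀ c ∈ I, deriv B c / B c = -(c / (1 - c)) * (deriv A₁ c / A₁ c))
    (hlog₂ : ∀ c ∈ I, deriv B c / B c = -((1 - c) / c) * (deriv A₂ c / A₂ c))
    (R : ℝ → ℝ) (hR : ∀ c, R c = (c / (1 - c)) ^ 2 * (A₂ c / A₁ c))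
    (R₁ : ℝ → ℝ) (hR₁ : ∀ c, R₁ c = A₁ c / c ^ 2)
    (R₂ : ℝ → ℝ) (hR₂ : ∀ c, R₂ c = A₂ c / (1 - c) ^ 2) :
    ∀ c ∈ I,
      deriv R₂ c / R₂ c =
        2 * (2 * c + 1 + 2 * c * R c) / (1 - c ^ 2 + c * (2 - c) * R c) ∧
      deriv R₁ c / R₁ c =
        -2 * (2 * (1 - c) + (3 - 2 * c) * R c) / (1 - c ^ 2 + c * (2 - c) * R c) := by
  intro c hc
  obtain ⟨h0, h1⟩ := hIsub hc
  have h1' : 0 < 1 - c := by linarith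
  have hc0 : c ≠ 0 := h0.ne'
  have hc1 : 1 - c ≠ 0 := h1'.ne'
  have p1 := hA₁pos c hc
  have p2 := hA₂pos c hc
  have pB := hBpos c hc
  have n1 := p1.ne'
  have n2 := p2.ne'
  have nB := pB.ne'
  have d1 : HasDerivAt R₁ (deriv A₁ c / c ^ 2 - 2 * A₁ c / c ^ 3) c := by
    have h := (hA₁diff c hc).hasDerivAt.div ((hasDerivAt_id c).pow 2) (by simpa using hc0)
    have e : R₁ = A₁ / (id ^ 2 : ℝ → ℝ) := by
      funext x; simp [hR₁]
    rw [e]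
    refine h.congr_deriv ?_
    simp
    field_simp
  have d2 : HasDerivAt R₂ (deriv A₂ c / (1 - c) ^ 2 + 2 * A₂ c / (1 - c) ^ 3) c := by
    have h := (hA₂diff c hc).hasDerivAt.div (((hasDerivAt_id c).const_sub 1).pow 2)
      (by simpa using hc1)
    have e : R₂ = A₂ / ((fun x : ℝ => 1 - id x) ^ 2 : ℝ → ℝ) := by
      funext x; simp [hR₂]
    rw [e]
    refine h.congr_deriv ?_
    simp
    field_simp
  have dS : deriv A₁ c / c ^ 2 - 2 * A₁ c / c ^ 3 +
      (deriv A₂ c / (1 - c) ^ 2 + 2 * A₂ c / (1 - c) ^ 3) = 2 * B c * deriv B c := by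
    have h := (d1.add d2)
    have hb := (hBdiff c hc).hasDerivAt.pow 2
    have e : (R₁ + R₂) =ᶠ[nhds c] B ^ 2 := by
      filter_upwards [hIopen.mem_nhds hc] with x hx
      simp [hR₁, hR₂, halg x hx]
    have := h.unique (hb.congr_of_eventuallyEq e)
    rw [this]; simp
  obtain ⟨b, hb⟩ : ∃ b, b = deriv B c / B c := ⟨_, rfl⟩
  have eB : deriv B c = b * B c := by rw [hb]; field_simp
  have e1 : deriv A₁ c = -((1 - c) / c) * b * A₁ c := by
    rw [hb, hlog₁ c hc]; field_simp
  have e2 : deriv A₂ c = -(c / (1 - c)) * b * A₂ c := by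
    rw [hb, hlog₂ c hc]; field_simp
  obtain ⟨r, hr⟩ : ∃ r, r = R c := ⟨_, rfl⟩
  have rpos : 0 < r := by rw [hr, hR]; positivity
  have eA : A₂ c = r * A₁ c * (1 - c) ^ 2 / c ^ 2 := by
    rw [hr, hR]; field_simp
  have hD : 0 < 1 - c ^ 2 + c * (2 - c) * r := by
    have : 0 < c * (2 - c) * r := by
      have : 0 < 2 - c := by linarith
      positivity
    nlinarith
  have hDn := hD.ne'
  have key : b * (1 - c ^ 2 + c * (2 - c) * r) = -2 * (1 - c) + 2 * c * r := by
    have hs : 2 * B c * deriv B c = 2 * b * (A₁ c / c ^ 2 + A₂ c / (1 - c) ^ 2) := by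
      rw [halg c hc, eB]; ring
    rw [hs, e1, e2, eA] at dS
    field_simp at dS
    linear_combination -dS
  have f2 : deriv R₂ c / R₂ c = (2 - c * b) / (1 - c) := by
    rw [d2.deriv, hR₂, e2]; field_simp; ring
  have f1 : deriv R₁ c / R₁ c = -((1 - c) * b + 2) / c := by
    rw [d1.deriv, hR₁, e1]; field_simp; ring
  rw [f1, f2, ← hr]
  constructor
  · rw [div_eq_div_iff hc1 hDn]
    linear_combination -c * key
  · rw [div_eq_div_iff hc0 hDn]
    linear_combination -(1 - c) * key
end

section
/- For all z₁, z₂ in the closed disk {z ∈ ℂ : |z| ≤ A·ε} with z₁ ≠ z₂, one has the lower bound |z₁·(z₁−ε)²·G(z₁) − z₂·(z₂−ε)²·G(z₂)| ≥ (ε²·|G(0)|/2)·|z₁ − z₂|. -/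
open Metric

/-- Quantitative lower bound for the difference quotient of
`z ↦ z (z-ε)² G(z)` on the disk `|z| ≤ Aε` (proof of Lemma 4.5 of the paper). -/
theorem diff_quotient_lower_bound
    (r K : ℝ) (hr : 0 < r) (hK : 0 < K)
    (G : ℂ → ℂ) (U : Set ℂ) (hUopen : IsOpen U) (hUsub : closedBall (0 : ℂ) r ⊆ U)
    (hG : DifferentiableOn ℂ G U)
    (hGbd : ∀ z : ℂ, ‖z‖ ≤ r → ‖G z‖ ≤ K)
    (hG'bd : ∀ z : ℂ, ‖z‖ ≤ r → ‖deriv G z‖ ≤ K)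
    (hGzG'bd : ∀ z : ℂ, ‖z‖ ≤ r → ‖G z + z * deriv G z‖ ≤ K)
    (hG0 : G 0 ≠ 0)
    (ε A : ℝ) (hε0 : 0 < ε) (hε1 : ε ≤ 1) (hA0 : 0 < A) (hA1 : A ≤ 1)
    (hAK : 20 * A * K ≤ ‖G 0‖) (hAr : A * ε ≤ r) :
    ∀ z₁ ∈ closedBall (0 : ℂ) (A * ε), ∀ z₂ ∈ closedBall (0 : ℂ) (A * ε), z₁ ≠ z₂ →
      ε ^ 2 * ‖G 0‖ / 2 * ‖z₁ - z₂‖ ≤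
        ‖z₁ * (z₁ - (ε : ℂ)) ^ 2 * G z₁ - z₂ * (z₂ - (ε : ℂ)) ^ 2 * G z₂‖ := by
  intro z₁ h₁ z₂ h₂ _
  have hd : ∀ z : ℂ, ‖z‖ ≤ A * ε → HasDerivAt G (deriv G z) z := by
    intro z hz
    have hzU : z ∈ U := hUsub (by simpa using hz.trans hAr)
    exact (hG.differentiableAt (hUopen.mem_nhds hzU)).hasDerivAt
  have hconv : Convex ℝ (closedBall (0 : ℂ) (A * ε)) := convex_closedBall _ _
  have hAε : 0 < A * ε := mul_pos hA0 hε0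
  have hG0' : ∀ z : ℂ, ‖z‖ ≤ A * ε → ‖G z - G 0‖ ≤ K * (A * ε) := by
    intro z hz
    have h := hconv.norm_image_sub_le_of_norm_hasDerivWithin_le (f := G) (f' := deriv G) (C := K)
      (x := 0) (y := z)
      (fun x hx => (hd x (by simpa using hx)).hasDerivWithinAt)
      (fun x hx => hG'bd x (le_trans (by simpa using hx) hAr))
      (by simpa using hAε.le) (by simpa using hz)
    rw [sub_zero] at h
    exact h.trans (by gcongr)
  have hbd : ∀ z : ℂ, ‖z‖ ≤ A * ε →
      ‖((z - ε) ^ 2 * (G z + z * deriv G z) + 2 * z * (z - ε) * G z) - ε ^ 2 * G 0‖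
        ≤ ε ^ 2 * ‖G 0‖ / 2 := by
    intro z hz
    have hzr := hz.trans hAr
    have e : ((z - ε) ^ 2 * (G z + z * deriv G z) + 2 * z * (z - ε) * G z) - ε ^ 2 * G 0
        = (ε : ℂ) ^ 2 * (G z - G 0) + (ε : ℂ) ^ 2 * (z * deriv G z)
          + z * (z - 2 * ε) * (G z + z * deriv G z) + 2 * z * (z - ε) * G z := by ring
    have nε : ‖(ε : ℂ)‖ = ε := by simp [abs_of_pos hε0]
    have n1 : ‖z - ε‖ ≤ A * ε + ε := (norm_sub_le _ _).trans (by rw [nε]; linarith)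
    have n2 : ‖z - 2 * ε‖ ≤ A * ε + 2 * ε := (norm_sub_le _ _).trans (by
      rw [norm_mul, nε]; simp; linarith)
    have b1 : ‖(ε : ℂ) ^ 2 * (G z - G 0)‖ ≤ ε ^ 2 * (K * (A * ε)) := by
      rw [norm_mul, norm_pow, nε]
      have := hG0' z hz
      gcongr
    have b2 : ‖(ε : ℂ) ^ 2 * (z * deriv G z)‖ ≤ ε ^ 2 * (A * ε * K) := by
      rw [norm_mul, norm_pow, nε, norm_mul]
      have := hG'bd z hzr
      gcongr
    have b3 : ‖z * (z - 2 * ε) * (G z + z * deriv G z)‖ ≤ (A * ε) * (A * ε + 2 * ε) * K := by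
      rw [norm_mul, norm_mul]
      have := hGzG'bd z hzr
      gcongr
    have b4 : ‖2 * z * (z - ε) * G z‖ ≤ 2 * (A * ε) * (A * ε + ε) * K := by
      rw [norm_mul, norm_mul, norm_mul, Complex.norm_ofNat]
      have := hGbd z hzr
      gcongr
    rw [e]
    have b := norm_add₄_le (a := (ε : ℂ) ^ 2 * (G z - G 0)) (b := (ε : ℂ) ^ 2 * (z * deriv G z))
      (c := z * (z - 2 * ε) * (G z + z * deriv G z)) (d := 2 * z * (z - ε) * G z)
    have t : 0 < ε ^ 2 * (A * K) := by positivity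
    have t1 : ε ^ 2 * (A * K) * ε ≤ ε ^ 2 * (A * K) := mul_le_of_le_one_right t.le hε1
    have t2 : ε ^ 2 * (A * K) * A ≤ ε ^ 2 * (A * K) := mul_le_of_le_one_right t.le hA1
    have t3 : ε ^ 2 * (20 * A * K) ≤ ε ^ 2 * ‖G 0‖ := by gcongr
    linarith
  have hD : ∀ z : ℂ, ‖z‖ ≤ A * ε → HasDerivAt
      (fun z : ℂ => z * (z - (ε : ℂ)) ^ 2 * G z - (ε : ℂ) ^ 2 * G 0 * z)
      (((z - ε) ^ 2 * (G z + z * deriv G z) + 2 * z * (z - ε) * G z) - ε ^ 2 * G 0) z := by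
    intro z hz
    have h := ((((hasDerivAt_id z).mul (((hasDerivAt_id z).sub_const (ε : ℂ)).pow 2)).mul
      (hd z hz)).sub ((hasDerivAt_id z).const_mul ((ε : ℂ) ^ 2 * G 0)))
    refine HasDerivAt.congr_deriv (f := fun z : ℂ => z * (z - (ε : ℂ)) ^ 2 * G z - (ε : ℂ) ^ 2 * G 0 * z) h ?_
    simp
    ring
  have h := hconv.norm_image_sub_le_of_norm_hasDerivWithin_le
    (fun x hx => (hD x (by simpa using hx)).hasDerivWithinAt)
    (fun x hx => hbd x (by simpa using hx)) h₂ h₁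
  have nε : ‖(ε : ℂ)‖ = ε := by simp [abs_of_pos hε0]
  have hn : ‖(ε : ℂ) ^ 2 * G 0 * (z₁ - z₂)‖ = ε ^ 2 * ‖G 0‖ * ‖z₁ - z₂‖ := by
    rw [norm_mul, norm_mul, norm_pow, nε]
  have tri := norm_sub_le
    (z₁ * (z₁ - (ε : ℂ)) ^ 2 * G z₁ - z₂ * (z₂ - (ε : ℂ)) ^ 2 * G z₂)
    ((z₁ * (z₁ - (ε : ℂ)) ^ 2 * G z₁ - (ε : ℂ) ^ 2 * G 0 * z₁)
      - (z₂ * (z₂ - (ε : ℂ)) ^ 2 * G z₂ - (ε : ℂ) ^ 2 * G 0 * z₂))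
  have e : (z₁ * (z₁ - (ε : ℂ)) ^ 2 * G z₁ - z₂ * (z₂ - (ε : ℂ)) ^ 2 * G z₂) -
    ((z₁ * (z₁ - (ε : ℂ)) ^ 2 * G z₁ - (ε : ℂ) ^ 2 * G 0 * z₁)
      - (z₂ * (z₂ - (ε : ℂ)) ^ 2 * G z₂ - (ε : ℂ) ^ 2 * G 0 * z₂))
      = (ε : ℂ) ^ 2 * G 0 * (z₁ - z₂) := by ring
  rw [e, hn] at tri
  linarith
end

section
/- The function z ↦ z·(z−ε)²·G(z) is injective on the closed disk {z ∈ ℂ : |z| ≤ A·ε}. -/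
open Metric

/-- The map `z ↦ z (z-ε)² G(z)` is injective on the disk `|z| ≤ Aε`
(conformality claim in the proof of Lemma 4.5 of the paper). -/
theorem cubic_map_injective
    (r K : ℝ) (hr : 0 < r) (hK : 0 < K)
    (G : ℂ → ℂ) (U : Set ℂ) (hUopen : IsOpen U) (hUsub : closedBall (0 : ℂ) r ⊆ U)
    (hG : DifferentiableOn ℂ G U)
    (hGbd : ∀ z : ℂ, ‖z‖ ≤ r → ‖G z‖ ≤ K)
    (hG'bd : ∀ z : ℂ, ‖z‖ ≤ r → ‖deriv G z‖ ≤ K)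
    (hGzG'bd : ∀ z : ℂ, ‖z‖ ≤ r → ‖G z + z * deriv G z‖ ≤ K)
    (hG0 : G 0 ≠ 0)
    (ε A : ℝ) (hε0 : 0 < ε) (hε1 : ε ≤ 1) (hA0 : 0 < A) (hA1 : A ≤ 1)
    (hAK : 20 * A * K ≤ ‖G 0‖) (hAr : A * ε ≤ r) :
    Set.InjOn (fun z : ℂ => z * (z - (ε : ℂ)) ^ 2 * G z)
      (closedBall (0 : ℂ) (A * ε)) := by
  intro z hz w hw hzw
  simp only [mem_closedBall, dist_zero_right] at hz hw
  simp only at hzw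
  by_contra hne
  have hd : 0 < ‖z - w‖ := norm_pos_iff.mpr (sub_ne_zero.mpr hne)
  have hG0K : ‖G 0‖ ≤ K := hGbd 0 (by simpa using hr.le)
  have hA20 : A ≤ 1 / 20 := by
    by_contra h
    push Not at h
    nlinarith
  have hlip : ∀ x y : ℂ, ‖x‖ ≤ r → ‖y‖ ≤ r → ‖G x - G y‖ ≤ K * ‖x - y‖ := by
    intro x y hx hy
    refine (convex_closedBall (0 : ℂ) r).norm_image_sub_le_of_norm_deriv_le
      (f := G) (C := K) (x := y) (y := x) ?_ ?_ (by simpa using hy) (by simpa using hx)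
    · intro t ht
      exact hG.differentiableAt (hUopen.mem_nhds (hUsub ht))
    · intro t ht
      exact hG'bd t (by simpa using ht)
  have hzr := hz.trans hAr
  have hwr := hw.trans hAr
  have h1 := hlip z w hzr hwr
  have h2 : ‖G z - G 0‖ ≤ K * (A * ε) := by
    have := hlip z 0 hzr (by simpa using hr.le)
    rw [sub_zero] at this
    exact this.trans (by gcongr)
  have hGz := hGbd z hzr
  have heps : ‖(ε : ℂ)‖ = ε := by simp [abs_of_pos hε0]
  have hQ : ‖z ^ 2 + z * w + w ^ 2 - 2 * ε * (z + w)‖ ≤ 3 * (A * ε) ^ 2 + 4 * ε * (A * ε) := by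
    calc _ ≤ ‖z‖ ^ 2 + ‖z‖ * ‖w‖ + ‖w‖ ^ 2 + 2 * ε * (‖z‖ + ‖w‖) := by
          refine (norm_sub_le _ _).trans ?_
          have ha : ‖z ^ 2 + z * w + w ^ 2‖ ≤ ‖z‖ ^ 2 + ‖z‖ * ‖w‖ + ‖w‖ ^ 2 := by
            refine (norm_add₃_le).trans ?_
            simp
          have hb : ‖2 * (ε : ℂ) * (z + w)‖ ≤ 2 * ε * (‖z‖ + ‖w‖) := by
            rw [norm_mul, norm_mul, heps, Complex.norm_two]
            gcongr
            exact norm_add_le _ _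
          linarith
      _ ≤ (A * ε) ^ 2 + (A * ε) * (A * ε) + (A * ε) ^ 2 + 2 * ε * (A * ε + A * ε) := by gcongr
      _ = _ := by ring
  have hP : ‖w * (w - ε) ^ 2‖ ≤ (A * ε) * (A * ε + ε) ^ 2 := by
    rw [norm_mul, norm_pow]
    gcongr
    refine (norm_sub_le _ _).trans ?_
    rw [heps]
    gcongr
  have key : (ε : ℂ) ^ 2 * G 0 * (z - w) =
      -((z - w) * (z ^ 2 + z * w + w ^ 2 - 2 * ε * (z + w)) * G z
        + ε ^ 2 * (z - w) * (G z - G 0) + w * (w - ε) ^ 2 * (G z - G w)) := by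
    linear_combination hzw
  have hn : ε ^ 2 * ‖G 0‖ * ‖z - w‖ ≤
      ‖z - w‖ * (3 * (A * ε) ^ 2 + 4 * ε * (A * ε)) * K
        + ε ^ 2 * ‖z - w‖ * (K * (A * ε)) + (A * ε) * (A * ε + ε) ^ 2 * (K * ‖z - w‖) := by
    calc _ = ‖(ε : ℂ) ^ 2 * G 0 * (z - w)‖ := by rw [norm_mul, norm_mul, norm_pow, heps]
      _ ≤ ‖(z - w) * (z ^ 2 + z * w + w ^ 2 - 2 * ε * (z + w)) * G z‖
        + ‖(ε : ℂ) ^ 2 * (z - w) * (G z - G 0)‖ + ‖w * (w - ε) ^ 2 * (G z - G w)‖ := by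
          rw [key, norm_neg]
          exact norm_add₃_le
      _ ≤ _ := by
          rw [norm_mul ((z - w) * _), norm_mul (z - w), norm_mul ((ε : ℂ) ^ 2 * _),
            norm_mul ((ε : ℂ) ^ 2), norm_pow, heps, norm_mul (w * _)]
          gcongr
  have hfac : 0 < ε ^ 2 * ‖z - w‖ := by positivity
  have hn2 : ε ^ 2 * ‖z - w‖ * ‖G 0‖ ≤
      ε ^ 2 * ‖z - w‖ * (A * K * (3 * A + 4 + ε + ε * (A + 1) ^ 2)) := by
    calc _ = ε ^ 2 * ‖G 0‖ * ‖z - w‖ := by ring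
      _ ≤ _ := hn
      _ = _ := by ring
  have hn3 := le_of_mul_le_mul_left hn2 hfac
  have hAK0 : 0 < A * K := by positivity
  have h4 : 3 * A + 4 + ε + ε * (A + 1) ^ 2 ≤ 3 * 1 + 4 + 1 + 1 * (1 + 1) ^ 2 := by gcongr
  nlinarith [mul_le_mul_of_nonneg_left h4 hAK0.le]
end

section
/- Let c₁ ∈ ℂ, r₁ > 0, and let f₁ be holomorphic on {z ∈ ℂ : |z − c₁| > r₁} with f₁(z) → 0 as |z| → ∞. Let f₂ be holomorphic on an open set containing the closed disk {z : |z − c₁| ≤ 2r₁}. Let ε ≥ 0 and suppose |f₁(s) + f₂(s)| ≤ ε for every s with |s − c₁| = 2r₁. Then for every z with |z − c₁| > 2r₁ one has |f₁(z)| ≤ 2·r₁·ε / (|z − c₁| − 2r₁); in particular |f₁(z)| ≤ 2ε whenever |z − c₁| ≥ 3r₁. -/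
open Metric Filter Bornology

/-- Exterior Cauchy-integral localization estimate: if `f₁` is holomorphic
outside the disk `|z-c₁| > r₁` and vanishes at infinity, `f₂` is holomorphic on a
neighborhood of `|z-c₁| ≤ 2r₁`, and `|f₁+f₂| ≤ ε` on the circle `|s-c₁| = 2r₁`, then
`|f₁(z)| ≤ 2r₁ε/(|z-c₁|-2r₁)` for `|z-c₁| > 2r₁`; in particular `|f₁(z)| ≤ 2ε` for
`|z-c₁| ≥ 3r₁`. -/
theorem exterior_cauchy_localization
    (c₁ : ℂ) (r₁ : ℝ) (hr₁ : 0 < r₁)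
    (f₁ f₂ : ℂ → ℂ)
    (hf₁ : DifferentiableOn ℂ f₁ {z : ℂ | r₁ < ‖z - c₁‖})
    (hf₁lim : Tendsto f₁ (cobounded ℂ) (nhds 0))
    (U : Set ℂ) (hUopen : IsOpen U) (hUsub : closedBall c₁ (2 * r₁) ⊆ U)
    (hf₂ : DifferentiableOn ℂ f₂ U)
    (ε : ℝ) (hε : 0 ≤ ε)
    (hbd : ∀ s : ℂ, ‖s - c₁‖ = 2 * r₁ → ‖f₁ s + f₂ s‖ ≤ ε) :
    (∀ z : ℂ, 2 * r₁ < ‖z - c₁‖ →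
      ‖f₁ z‖ ≤ 2 * r₁ * ε / (‖z - c₁‖ - 2 * r₁)) ∧
    (∀ z : ℂ, 3 * r₁ ≤ ‖z - c₁‖ → ‖f₁ z‖ ≤ 2 * ε) := by
  have key : ∀ z : ℂ, 2 * r₁ < ‖z - c₁‖ →
      ‖f₁ z‖ ≤ 2 * r₁ * ε / (‖z - c₁‖ - 2 * r₁) := by
    intro z hz
    have hop : IsOpen {z : ℂ | r₁ < ‖z - c₁‖} :=
      isOpen_lt continuous_const (by fun_prop)
    have hzmem : {z : ℂ | r₁ < ‖z - c₁‖} ∈ nhds z :=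
      hop.mem_nhds (by simp only [Set.mem_setOf_eq]; linarith)
    have hg : DifferentiableOn ℂ (dslope f₁ z) {z : ℂ | r₁ < ‖z - c₁‖} :=
      (Complex.differentiableOn_dslope hzmem).2 hf₁
    have hsph : ∀ R, 2 * r₁ ≤ R → sphere c₁ R ⊆ {z : ℂ | r₁ < ‖z - c₁‖} := by
      intro R hR s hs
      rw [mem_sphere_iff_norm] at hs
      simp only [Set.mem_setOf_eq]; linarith
    have hinv : ∀ R, R ≠ ‖z - c₁‖ → ContinuousOn (fun s : ℂ => (s - z)⁻¹) (sphere c₁ R) := by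
      intro R hR
      apply ContinuousOn.inv₀ (by fun_prop)
      intro s hs h
      rw [mem_sphere_iff_norm] at hs
      rw [sub_eq_zero.1 h] at hs
      exact hR hs.symm
    -- splitting the integral of the slope
    have hsplit : ∀ R, 2 * r₁ ≤ R → R ≠ ‖z - c₁‖ →
        (∮ s in C(c₁, R), dslope f₁ z s) =
          (∮ s in C(c₁, R), (s - z)⁻¹ * f₁ s) - (∮ s in C(c₁, R), (s - z)⁻¹) * f₁ z := by
      intro R hR hne
      have hR0 : 0 ≤ R := by linarith
      have h1 : CircleIntegrable (fun s => (s - z)⁻¹ * f₁ s) c₁ R :=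
        ((hinv R hne).mul (hf₁.continuousOn.mono (hsph R hR))).circleIntegrable hR0
      have h2 : CircleIntegrable (fun s => (s - z)⁻¹ * f₁ z) c₁ R :=
        ((hinv R hne).mul continuousOn_const).circleIntegrable hR0
      have h3 : (∮ s in C(c₁, R), (s - z)⁻¹ * f₁ z) = (∮ s in C(c₁, R), (s - z)⁻¹) * f₁ z := by
        have := circleIntegral.integral_const_mul (f₁ z) (fun s => (s - z)⁻¹) c₁ R
        simpa only [mul_comm] using this
      rw [← h3, ← circleIntegral.integral_sub h1 h2]
      apply circleIntegral.integral_congr hR0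
      intro s hs
      have hsz : s ≠ z := by
        rintro rfl
        exact hne (mem_sphere_iff_norm.1 hs).symm
      simp only [dslope_of_ne _ hsz, slope_def_field]
      rw [div_eq_inv_mul]; ring
    have hzc : ∀ s ∈ closedBall c₁ (2 * r₁), s - z ≠ 0 := by
      intro s hs h
      rw [mem_closedBall_iff_norm, sub_eq_zero.1 h] at hs
      linarith
    have hdinv : DifferentiableOn ℂ (fun s : ℂ => (s - z)⁻¹) (closedBall c₁ (2 * r₁)) :=
      DifferentiableOn.inv (by fun_prop) hzc
    have hzero : ∀ F : ℂ → ℂ, DifferentiableOn ℂ F (closedBall c₁ (2 * r₁)) →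
        (∮ s in C(c₁, 2 * r₁), F s) = 0 := by
      intro F hF
      apply DiffContOnCl.circleIntegral_eq_zero (by linarith)
      apply DifferentiableOn.diffContOnCl
      exact hF.mono closure_ball_subset_closedBall
    have hne : 2 * r₁ ≠ ‖z - c₁‖ := hz.ne
    have h2r : 0 ≤ 2 * r₁ := by linarith
    have hin := hsplit (2 * r₁) le_rfl hne
    rw [hzero _ hdinv, zero_mul, sub_zero] at hin
    have hf2z := hzero _ (hdinv.mul (hf₂.mono hUsub))
    have hsum : (∮ s in C(c₁, 2 * r₁), (s - z)⁻¹ * (f₁ s + f₂ s)) =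
        ∮ s in C(c₁, 2 * r₁), (s - z)⁻¹ * f₁ s := by
      have h1 : CircleIntegrable (fun s => (s - z)⁻¹ * f₁ s) c₁ (2 * r₁) :=
        ((hinv _ hne).mul (hf₁.continuousOn.mono (hsph _ le_rfl))).circleIntegrable h2r
      have h2 : CircleIntegrable (fun s => (s - z)⁻¹ * f₂ s) c₁ (2 * r₁) :=
        ((hinv _ hne).mul (hf₂.continuousOn.mono
          (sphere_subset_closedBall.trans hUsub))).circleIntegrable h2r
      have h3 := circleIntegral.integral_add h1 h2
      have h4 : (∮ s in C(c₁, 2 * r₁), (s - z)⁻¹ * f₂ s) = 0 := hf2z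
      rw [h4, add_zero] at h3
      rw [← h3]
      simp only [mul_add]
    have hd : 0 < ‖z - c₁‖ - 2 * r₁ := by linarith
    have hbin : ‖∮ s in C(c₁, 2 * r₁), dslope f₁ z s‖ ≤
        2 * Real.pi * (2 * r₁) * (ε / (‖z - c₁‖ - 2 * r₁)) := by
      rw [hin, ← hsum]
      apply circleIntegral.norm_integral_le_of_norm_le_const h2r
      intro s hs
      rw [mem_sphere_iff_norm] at hs
      have h1 := hbd s hs
      have h2 : ‖z - c₁‖ - 2 * r₁ ≤ ‖s - z‖ := by
        have := norm_sub_norm_le (z - c₁) (s - c₁)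
        rw [sub_sub_sub_cancel_right, norm_sub_rev z s] at this
        linarith
      rw [norm_mul, norm_inv, ← div_eq_inv_mul]
      gcongr
    have hpi := Real.pi_pos
    apply le_of_forall_pos_le_add
    intro δ hδ
    have hev : ∀ᶠ s in cobounded ℂ, ‖f₁ s‖ < δ / 2 := by
      have := hf₁lim.norm
      rw [norm_zero] at this
      exact this.eventually (gt_mem_nhds (by linarith))
    obtain ⟨T, -, hT⟩ := (hasBasis_cobounded_compl_closedBall c₁).eventually_iff.1 hev
    obtain ⟨R, hRT, hRz⟩ : ∃ R, T < R ∧ 2 * ‖z - c₁‖ ≤ R :=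
      ⟨max (T + 1) (2 * ‖z - c₁‖), lt_of_lt_of_le (by linarith) (le_max_left _ _), le_max_right _ _⟩
    have hR0 : 0 < R := by linarith
    have hzR : ‖z - c₁‖ < R := by linarith
    have hout := hsplit R (by linarith) hzR.ne'
    rw [circleIntegral.integral_sub_inv_of_mem_ball (mem_ball_iff_norm.2 hzR)] at hout
    have hbout : ‖∮ s in C(c₁, R), (s - z)⁻¹ * f₁ s‖ ≤ 2 * Real.pi * R * (δ / 2 / (R / 2)) := by
      apply circleIntegral.norm_integral_le_of_norm_le_const hR0.le
      intro s hs
      rw [mem_sphere_iff_norm] at hs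
      have h1 : ‖f₁ s‖ < δ / 2 := hT (by
        simp only [Set.mem_compl_iff, mem_closedBall_iff_norm, not_le]; linarith)
      have h2 : R / 2 ≤ ‖s - z‖ := by
        have := norm_sub_norm_le (s - c₁) (z - c₁)
        rw [sub_sub_sub_cancel_right] at this
        linarith
      rw [norm_mul, norm_inv, ← div_eq_inv_mul]
      gcongr
    have heq : (∮ s in C(c₁, R), dslope f₁ z s) = ∮ s in C(c₁, 2 * r₁), dslope f₁ z s := by
      apply Complex.circleIntegral_eq_of_differentiable_on_annulus_off_countable
        (by linarith) (by linarith) Set.countable_empty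
      · refine hg.continuousOn.mono ?_
        rintro s ⟨-, hs⟩
        rw [mem_ball_iff_norm, not_lt] at hs
        simp only [Set.mem_setOf_eq]; linarith
      · rintro s ⟨⟨-, hs⟩, -⟩
        rw [mem_closedBall_iff_norm, not_le] at hs
        apply hg.differentiableAt (hop.mem_nhds _)
        simp only [Set.mem_setOf_eq]; linarith
    have hfin : 2 * Real.pi * Complex.I * f₁ z =
        (∮ s in C(c₁, R), (s - z)⁻¹ * f₁ s) - ∮ s in C(c₁, 2 * r₁), dslope f₁ z s := by
      rw [← heq, hout]; ring
    have hn : 2 * Real.pi * ‖f₁ z‖ ≤ 2 * Real.pi * R * (δ / 2 / (R / 2)) +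
        2 * Real.pi * (2 * r₁) * (ε / (‖z - c₁‖ - 2 * r₁)) := by
      have h1 : ‖2 * Real.pi * Complex.I * f₁ z‖ = 2 * Real.pi * ‖f₁ z‖ := by
        simp [abs_of_pos hpi]
      rw [← h1, hfin]
      exact (norm_sub_le _ _).trans (add_le_add hbout hbin)
    have e1 : 2 * Real.pi * R * (δ / 2 / (R / 2)) = 2 * Real.pi * δ := by
      field_simp
    have e2 : 2 * Real.pi * (2 * r₁) * (ε / (‖z - c₁‖ - 2 * r₁)) =
        2 * Real.pi * (2 * r₁ * ε / (‖z - c₁‖ - 2 * r₁)) := by ring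
    rw [e1, e2, ← mul_add] at hn
    have := le_of_mul_le_mul_left hn (by positivity)
    linarith
  refine ⟨key, fun z hz => (key z (by linarith)).trans ?_⟩
  rw [div_le_iff₀ (by linarith)]
  nlinarith
end

section
/- Let α < β be real numbers, ρ : ℝ → ℂ continuous on [α,β], n a nonnegative integer, and P a polynomial such that ∫_α^β xˡ·P(x)·ρ(x) dx = 0 for every integer 0 ≤ l < n. Define, for z ∈ ℂ \ [α,β], R(z) := (1/(2πi)) ∫_α^β P(x)·ρ(x)/(x−z) dx. Then z^{n+1}·R(z) → −(1/(2πi)) ∫_α^β x^n·P(x)·ρ(x) dx as |z| → ∞ (limit along the filter of complements of bounded sets in ℂ). In particular, R(z) = O(z^{−n−1}) at infinity. -/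
open Filter Bornology Asymptotics Polynomial

lemma aux_far (α β : ℝ) : ∃ M : ℝ, ∀ x ∈ Set.Icc α β, ‖(x : ℂ)‖ ≤ M := by
  refine ⟨max |α| |β|, fun x hx => ?_⟩
  rw [Complex.norm_real, Real.norm_eq_abs]
  exact abs_le_max_abs_abs hx.1 hx.2

lemma aux_tendsto (α β : ℝ) (hαβ : α < β) (g : ℝ → ℂ) (hg : ContinuousOn g (Set.Icc α β)) :
    Tendsto (fun z : ℂ => ∫ x in α..β, g x / ((x : ℂ) - z)) (cobounded ℂ) (nhds 0) := by
  obtain ⟨M, hM⟩ := aux_far α β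
  obtain ⟨C, hC⟩ := isCompact_Icc.exists_bound_of_continuousOn hg
  have hlim : Tendsto (fun z : ℂ => C / (‖z‖ - M) * |β - α|) (cobounded ℂ) (nhds 0) := by
    have h1 : Tendsto (fun z : ℂ => ‖z‖ - M) (cobounded ℂ) atTop :=
      tendsto_atTop_add_const_right _ (-M) tendsto_norm_cobounded_atTop
    simpa using (h1.const_div_atTop C).mul_const |β - α|
  refine squeeze_zero_norm' ?_ hlim
  filter_upwards [tendsto_norm_cobounded_atTop.eventually_gt_atTop M] with z hz
  refine intervalIntegral.norm_integral_le_of_norm_le_const fun x hx => ?_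
  rw [Set.uIoc_of_le hαβ.le] at hx
  have hx' := Set.Ioc_subset_Icc_self hx
  rw [norm_div]
  have h2 : ‖z‖ - M ≤ ‖(x : ℂ) - z‖ := by
    have := norm_sub_norm_le z (x : ℂ)
    rw [norm_sub_rev] at this
    linarith [hM x hx']
  have h3 : 0 < ‖z‖ - M := by linarith
  have := hC x hx'
  have h4 : 0 ≤ C := (norm_nonneg _).trans this
  gcongr

lemma aux_step (α β : ℝ) (hαβ : α < β) (g : ℝ → ℂ) (hg : ContinuousOn g (Set.Icc α β))
    (z : ℂ) (hz : ∀ x ∈ Set.Icc α β, (x : ℂ) - z ≠ 0) :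
    z * (∫ x in α..β, g x / ((x : ℂ) - z)) =
      (∫ x in α..β, ((x : ℂ) * g x) / ((x : ℂ) - z)) - ∫ x in α..β, g x := by
  have hx : ContinuousOn (fun x : ℝ => (x : ℂ)) (Set.Icc α β) :=
    Complex.continuous_ofReal.continuousOn
  rw [← Set.uIcc_of_le hαβ.le] at *
  rw [← intervalIntegral.integral_sub, ← intervalIntegral.integral_const_mul]
  · refine intervalIntegral.integral_congr fun x h => ?_
    have := hz x h
    field_simp
    ring
  · exact ((hx.mul hg).div (hx.sub continuousOn_const) hz).intervalIntegrable
  · exact hg.intervalIntegrable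

/-- If the polynomial `P` is orthogonal to `1, x, …, x^{n-1}` with respect to
`ρ(x)dx` on `[α,β]`, then the second-kind function
`R(z) = (1/(2πi)) ∫ P(x)ρ(x)/(x-z) dx` satisfies
`z^{n+1} R(z) → -(1/(2πi)) ∫ x^n P(x)ρ(x) dx` as `|z| → ∞`; in particular
`R(z) = O(z^{-n-1})` at infinity (equation (4.1) of the paper). -/
theorem second_kind_function_asymp
    (α β : ℝ) (hαβ : α < β)
    (ρ : ℝ → ℂ) (hρ : ContinuousOn ρ (Set.Icc α β))
    (n : ℕ) (P : Polynomial ℂ)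
    (horth : ∀ l : ℕ, l < n →
      (∫ x in α..β, (x : ℂ) ^ l * P.eval (x : ℂ) * ρ x) = 0)
    (R : ℂ → ℂ)
    (hR : ∀ z : ℂ, R z = (1 / (2 * Real.pi * Complex.I)) *
      ∫ x in α..β, P.eval (x : ℂ) * ρ x / ((x : ℂ) - z)) :
    Tendsto (fun z : ℂ => z ^ (n + 1) * R z) (cobounded ℂ)
      (nhds (-(1 / (2 * Real.pi * Complex.I)) *
        ∫ x in α..β, (x : ℂ) ^ n * P.eval (x : ℂ) * ρ x)) ∧
    R =O[cobounded ℂ] fun z : ℂ => (z ^ (n + 1))⁻¹ := by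
  obtain ⟨M, hM⟩ := aux_far α β
  have hx : ContinuousOn (fun x : ℝ => (x : ℂ)) (Set.Icc α β) :=
    Complex.continuous_ofReal.continuousOn
  have hP : ContinuousOn (fun x : ℝ => P.eval (x : ℂ)) (Set.Icc α β) :=
    (P.continuous.comp Complex.continuous_ofReal).continuousOn
  have hg : ∀ k : ℕ, ContinuousOn (fun x : ℝ => (x : ℂ) ^ k * P.eval (x : ℂ) * ρ x)
      (Set.Icc α β) := fun k => ((hx.pow k).mul hP).mul hρ
  have hstep : ∀ z : ℂ, M < ‖z‖ → ∀ k : ℕ,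
      z * (∫ x in α..β, (x : ℂ) ^ k * P.eval (x : ℂ) * ρ x / ((x : ℂ) - z)) =
      (∫ x in α..β, (x : ℂ) ^ (k + 1) * P.eval (x : ℂ) * ρ x / ((x : ℂ) - z)) -
        ∫ x in α..β, (x : ℂ) ^ k * P.eval (x : ℂ) * ρ x := by
    intro z hz k
    rw [aux_step α β hαβ _ (hg k) z]
    · congr 2
      ext x
      ring
    · intro x h h0
      have := hM x h
      rw [sub_eq_zero.mp h0] at this
      linarith
  have hpow : ∀ z : ℂ, M < ‖z‖ → ∀ k : ℕ, k ≤ n →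
      z ^ k * (∫ x in α..β, P.eval (x : ℂ) * ρ x / ((x : ℂ) - z)) =
      ∫ x in α..β, (x : ℂ) ^ k * P.eval (x : ℂ) * ρ x / ((x : ℂ) - z) := by
    intro z hz k
    induction k with
    | zero => intro _; simp
    | succ k ih =>
      intro hk
      rw [pow_succ', mul_assoc, ih (by omega), hstep z hz, horth k (by omega), sub_zero]
  have hT : Tendsto (fun z : ℂ => z ^ (n + 1) * R z) (cobounded ℂ)
      (nhds (-(1 / (2 * Real.pi * Complex.I)) *
        ∫ x in α..β, (x : ℂ) ^ n * P.eval (x : ℂ) * ρ x)) := by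
    have h1 := ((aux_tendsto α β hαβ _ (hg (n + 1))).sub_const
      (∫ x in α..β, (x : ℂ) ^ n * P.eval (x : ℂ) * ρ x)).const_mul
        (1 / (2 * Real.pi * Complex.I))
    rw [zero_sub, mul_neg, ← neg_mul] at h1
    refine h1.congr' ?_
    filter_upwards [tendsto_norm_cobounded_atTop.eventually_gt_atTop M] with z hz
    rw [← hstep z hz, ← hpow z hz n le_rfl, hR]
    ring
  refine ⟨hT, ?_⟩
  have h2 := (hT.isBigO_one ℂ).mul (isBigO_refl (fun z : ℂ => (z ^ (n + 1))⁻¹) (cobounded ℂ))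
  refine h2.congr' ?_ (by simp)
  filter_upwards [tendsto_norm_cobounded_atTop.eventually_gt_atTop 0] with z hz
  have : z ≠ 0 := norm_pos_iff.mp hz
  field_simp
end

section
/- Let α < β be real numbers and let w be a function holomorphic on ℂ \ [α,β] with w(z)² = (z−α)(z−β) for all z in its domain and w(z) − z → −(α+β)/2 as |z| → ∞. Let u : ℝ → ℂ be continuous on [α,β] and define, for z ∈ ℂ \ [α,β], F(z) := −(w(z)/(2π)) ∫_α^β u(x) / ((z−x)·√((x−α)(β−x))) dx. Then, with L := −(1/(2π)) ∫_α^β u(x)/√((x−α)(β−x)) dx, one has: (a) F(z) → L as |z| → ∞, and (b) z·(F(z) − L) → −(1/(2π)) ∫_α^β u(x)·(x − (α+β)/2)/√((x−α)(β−x)) dx as |z| → ∞ (limits along the filter of complements of bounded sets in ℂ). -/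
open Filter Bornology

lemma aux_kernel_integrable (α β : ℝ) (hαβ : α < β) :
    IntervalIntegrable (fun x : ℝ => (Real.sqrt ((x - α) * (β - x)))⁻¹)
      MeasureTheory.volume α β := by
  refine intervalIntegral.intervalIntegrable_deriv_of_nonneg
    (g := fun x : ℝ => Real.arcsin ((2 * x - α - β) / (β - α))) ?_ ?_ ?_
  · exact (Real.continuous_arcsin.comp (by fun_prop)).continuousOn
  · intro x hx
    rw [min_eq_left hαβ.le, max_eq_right hαβ.le] at hx
    obtain ⟨h1, h2⟩ := hx
    have hd : 0 < β - α := sub_pos.2 hαβ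
    have hp : 0 < (x - α) * (β - x) := mul_pos (by linarith) (by linarith)
    have hne1 : (2 * x - α - β) / (β - α) ≠ -1 := by
      intro h
      rw [div_eq_iff hd.ne'] at h
      linarith
    have hne2 : (2 * x - α - β) / (β - α) ≠ 1 := by
      intro h
      rw [div_eq_iff hd.ne'] at h
      linarith
    have hi : HasDerivAt (fun x : ℝ => (2 * x - α - β) / (β - α)) (2 / (β - α)) x := by
      have := ((((hasDerivAt_id x).const_mul 2).sub_const α).sub_const β).div_const (β - α)
      simpa using this
    have := (Real.hasDerivAt_arcsin hne1 hne2).comp x hi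
    refine this.congr_deriv ?_
    have e : 1 - ((2 * x - α - β) / (β - α)) ^ 2
        = ((x - α) * (β - x)) * (2 / (β - α)) ^ 2 := by
      field_simp
      ring
    have hs : 0 < Real.sqrt ((x - α) * (β - x)) := Real.sqrt_pos.2 hp
    rw [e, Real.sqrt_mul hp.le, Real.sqrt_sq (by positivity)]
    field_simp
  · intro x _
    positivity

lemma aux_bound (M : ℝ) (x : ℝ) (z : ℂ) (hx : |x| ≤ M) (hz : 2 * M + 1 ≤ ‖z‖) :
    z - (x : ℂ) ≠ 0 ∧ ‖z / (z - (x : ℂ))‖ ≤ 2 := by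
  have hM : 0 ≤ M := (abs_nonneg x).trans hx
  have h1 : ‖z‖ - |x| ≤ ‖z - (x : ℂ)‖ := by
    have := norm_sub_norm_le z (x : ℂ)
    simpa using this
  have hpos : 0 < ‖z - (x : ℂ)‖ := by linarith
  refine ⟨norm_pos_iff.1 hpos, ?_⟩
  rw [norm_div, div_le_iff₀ hpos]
  linarith

lemma aux_abs (α β x : ℝ) (hx : x ∈ Set.Icc α β) : |x| ≤ |α| + |β| := by
  rw [abs_le]
  constructor
  · linarith [neg_abs_le α, abs_nonneg β, hx.1]
  · linarith [le_abs_self β, abs_nonneg α, hx.2]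

lemma aux_large (R : ℝ) : ∀ᶠ z : ℂ in cobounded ℂ, R ≤ ‖z‖ :=
  tendsto_norm_cobounded_atTop.eventually_ge_atTop R

lemma aux_int (α β : ℝ) (hαβ : α < β) (h : ℝ → ℂ)
    (hh : IntervalIntegrable h MeasureTheory.volume α β) (z : ℂ)
    (hz : 2 * (|α| + |β|) + 1 ≤ ‖z‖) :
    IntervalIntegrable (fun x : ℝ => h x * (z / (z - (x : ℂ)))) MeasureTheory.volume α β := by
  refine hh.mul_continuousOn ?_
  rw [Set.uIcc_of_le hαβ.le]
  refine ContinuousOn.div (by fun_prop) (by fun_prop) ?_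
  intro x hx
  exact (aux_bound _ x z (aux_abs α β x hx) hz).1

lemma aux_lim (α β : ℝ) (hαβ : α < β) (h : ℝ → ℂ)
    (hh : IntervalIntegrable h MeasureTheory.volume α β) :
    Tendsto (fun z : ℂ => ∫ x in α..β, h x * (z / (z - (x : ℂ)))) (cobounded ℂ)
      (nhds (∫ x in α..β, h x)) := by
  have : (cobounded ℂ).IsCountablyGenerated := by
    rw [← comap_norm_atTop]
    infer_instance
  refine intervalIntegral.tendsto_integral_filter_of_dominated_convergence
    (fun x => ‖h x‖ * 2) ?_ ?_ ?_ ?_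
  · filter_upwards [aux_large (2 * (|α| + |β|) + 1)] with z hz
    have := (aux_int α β hαβ h hh z hz).aestronglyMeasurable
    rwa [Set.uIoc_of_le hαβ.le]
  · filter_upwards [aux_large (2 * (|α| + |β|) + 1)] with z hz
    refine Eventually.of_forall fun x hx => ?_
    rw [Set.uIoc_of_le hαβ.le] at hx
    rw [norm_mul]
    exact mul_le_mul_of_nonneg_left
      (aux_bound _ x z (aux_abs α β x ⟨hx.1.le, hx.2⟩) hz).2 (norm_nonneg _)
  · exact hh.norm.mul_const 2
  · refine Eventually.of_forall fun x hx => ?_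
    rw [Set.uIoc_of_le hαβ.le] at hx
    have hinv : Tendsto (fun z : ℂ => z⁻¹) (cobounded ℂ) (nhds 0) := tendsto_inv₀_cobounded
    have h1 : Tendsto (fun z : ℂ => h x * (1 - (x : ℂ) * z⁻¹)⁻¹) (cobounded ℂ)
        (nhds (h x * (1 - (x : ℂ) * 0)⁻¹)) :=
      ((tendsto_const_nhds.sub (hinv.const_mul _)).inv₀ (by simp)).const_mul _
    simp only [mul_zero, sub_zero, inv_one, mul_one] at h1
    refine h1.congr' ?_
    filter_upwards [aux_large (2 * (|α| + |β|) + 1)] with z hz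
    have hb := (aux_bound _ x z (aux_abs α β x ⟨hx.1.le, hx.2⟩) hz).1
    have hz0 : z ≠ 0 := by
      rintro rfl
      rw [norm_zero] at hz
      linarith [abs_nonneg α, abs_nonneg β]
    have : 1 - (x : ℂ) * z⁻¹ = (z - x) / z := by field_simp
    rw [this, inv_div]

/-- Asymptotic expansion at infinity of the Szegő-type Cauchy integral
`F(z) = -(w(z)/(2π)) ∫ u(x)/((z-x)√((x-α)(β-x))) dx`: one has `F(z) → L` and
`z(F(z)-L) → -(1/(2π)) ∫ u(x)(x-(α+β)/2)/√((x-α)(β-x)) dx` as `|z| → ∞`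
(Section 9.5 of the paper). -/
theorem szego_cauchy_integral_asymp
    (α β : ℝ) (hαβ : α < β)
    (w : ℂ → ℂ)
    (hw : DifferentiableOn ℂ w {z : ℂ | z ∉ Complex.ofReal '' Set.Icc α β})
    (hwsq : ∀ z ∈ {z : ℂ | z ∉ Complex.ofReal '' Set.Icc α β},
      (w z) ^ 2 = (z - (α : ℂ)) * (z - (β : ℂ)))
    (hwlim : Tendsto (fun z : ℂ => w z - z) (cobounded ℂ)
      (nhds ((-((α + β) / 2) : ℝ) : ℂ)))
    (u : ℝ → ℂ) (hu : ContinuousOn u (Set.Icc α β))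
    (F : ℂ → ℂ)
    (hF : ∀ z : ℂ, F z = -(w z / ((2 * Real.pi : ℝ) : ℂ)) *
      ∫ x in α..β, u x / ((z - (x : ℂ)) * (Real.sqrt ((x - α) * (β - x)) : ℂ)))
    (L : ℂ)
    (hL : L = -(1 / ((2 * Real.pi : ℝ) : ℂ)) *
      ∫ x in α..β, u x / (Real.sqrt ((x - α) * (β - x)) : ℂ)) :
    Tendsto F (cobounded ℂ) (nhds L) ∧
    Tendsto (fun z : ℂ => z * (F z - L)) (cobounded ℂ)
      (nhds (-(1 / ((2 * Real.pi : ℝ) : ℂ)) *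
        ∫ x in α..β, u x * ((x : ℂ) - ((α + β) / 2 : ℝ)) /
          (Real.sqrt ((x - α) * (β - x)) : ℂ))) := by
  have hk := aux_kernel_integrable α β hαβ
  set g : ℝ → ℂ := fun x => u x / (Real.sqrt ((x - α) * (β - x)) : ℂ) with hg
  have hgi : IntervalIntegrable g MeasureTheory.volume α β := by
    have hkc : IntervalIntegrable
        (fun x : ℝ => (((Real.sqrt ((x - α) * (β - x)))⁻¹ : ℝ) : ℂ))
        MeasureTheory.volume α β := ⟨hk.1.ofReal, hk.2.ofReal⟩
    have := hkc.continuousOn_mul (g := u) (by rwa [Set.uIcc_of_le hαβ.le])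
    refine this.congr fun x _ => ?_
    simp [hg, div_eq_mul_inv]
  have hgx : IntervalIntegrable (fun x : ℝ => g x * (x : ℂ)) MeasureTheory.volume α β :=
    hgi.mul_continuousOn (by fun_prop)
  have l0 := aux_lim α β hαβ g hgi
  have l1 := aux_lim α β hαβ _ hgx
  have hI : (∫ x in α..β, u x * ((x : ℂ) - ((α + β) / 2 : ℝ)) /
          (Real.sqrt ((x - α) * (β - x)) : ℂ))
      = ((-((α + β) / 2) : ℝ) : ℂ) * (∫ x in α..β, g x) + ∫ x in α..β, g x * (x : ℂ) := by
    rw [← intervalIntegral.integral_const_mul, ← intervalIntegral.integral_add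
      (hgi.const_mul _) hgx]
    refine intervalIntegral.integral_congr fun x _ => ?_
    simp only [hg]
    push_cast
    ring
  have key : Tendsto (fun z : ℂ => z * (F z - L)) (cobounded ℂ)
      (nhds (-(1 / ((2 * Real.pi : ℝ) : ℂ)) *
        ∫ x in α..β, u x * ((x : ℂ) - ((α + β) / 2 : ℝ)) /
          (Real.sqrt ((x - α) * (β - x)) : ℂ))) := by
    rw [hI]
    refine (((hwlim.mul l0).add l1).const_mul _).congr' ?_
    filter_upwards [aux_large (2 * (|α| + |β|) + 1)] with z hz
    have hz0 : z ≠ 0 := by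
      rintro rfl
      rw [norm_zero] at hz
      linarith [abs_nonneg α, abs_nonneg β]
    have eJ : (∫ x in α..β, g x * (z / (z - (x : ℂ))))
        = z * ∫ x in α..β, u x / ((z - (x : ℂ)) * (Real.sqrt ((x - α) * (β - x)) : ℂ)) := by
      rw [← intervalIntegral.integral_const_mul]
      refine intervalIntegral.integral_congr fun x _ => ?_
      simp only [hg, div_eq_mul_inv, mul_inv]
      ring
    have e1 : (∫ x in α..β, g x * (x : ℂ) * (z / (z - (x : ℂ))))
        = z * ((∫ x in α..β, g x * (z / (z - (x : ℂ)))) - ∫ x in α..β, g x) := by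
      rw [← intervalIntegral.integral_sub (aux_int α β hαβ g hgi z hz) hgi,
        ← intervalIntegral.integral_const_mul]
      refine intervalIntegral.integral_congr fun x hx => ?_
      rw [Set.uIcc_of_le hαβ.le] at hx
      have hb := (aux_bound _ x z (aux_abs α β x hx) hz).1
      field_simp
      ring
    rw [e1, eJ, hF, hL]
    ring
  refine ⟨?_, key⟩
  have hinv : Tendsto (fun z : ℂ => z⁻¹) (cobounded ℂ) (nhds 0) := tendsto_inv₀_cobounded
  have h2 := (hinv.mul key).add_const L
  rw [zero_mul, zero_add] at h2
  refine h2.congr' ?_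
  filter_upwards [aux_large 1] with z hz
  have hz0 : z ≠ 0 := by
    rintro rfl
    rw [norm_zero] at hz
    linarith
  rw [inv_mul_cancel_left₀ hz0, sub_add_cancel]
end
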